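/- Let V be a unitary operator with simple continuous spectrum on a Hilbert space H such that the k-th symmetric power V^{⊙k} also has simple spectrum, and let Γ be a subgroup of the symmetric group S_k acting on H^{⊗k} by permuting tensor factors. Then the restriction of V^{⊗k} to the subspace of Γ-invariant tensors has homogeneous spectrum of multiplicity k!/|Γ|. -/

import Mathlib

open MeasureTheory
open scoped ENNReal

noncomputable instance : MeasurableSpace Circle := borel Circle
instance : BorelSpace Circle := ⟨rfl⟩


/-- The underlying (a.e. defined) function of an element of `L²`. -/
noncomputable def lpFun {α : Type*} [MeasurableSpace α] {μ : MeasureTheory.Measure α}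
    (f : MeasureTheory.Lp ℂ 2 μ) : α → ℂ := ↑↑f

/-- A unitary operator has *simple spectrum* if it admits a cyclic vector. -/
def HasSimpleSpectrum {E : Type*} [NormedAddCommGroup E] [InnerProductSpace ℂ E]
    (U : E ≃ₗᵢ[ℂ] E) : Prop :=
  ∃ ξ : E, Dense (Submodule.span ℂ (Set.range fun n : ℤ => (U ^ n) ξ) : Set E)

/-- A unitary operator has *homogeneous spectrum of multiplicity `m`* if it is
unitarily equivalent to the direct sum of `m` copies of a unitary operator with
simple spectrum. -/
def HasHomogeneousSpectrumOfMultiplicity {E : Type*} [NormedAddCommGroup E]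
    [InnerProductSpace ℂ E] (U : E ≃ₗᵢ[ℂ] E) (m : ℕ) : Prop :=
  ∃ (H₀ : Type) (_ : NormedAddCommGroup H₀) (_ : InnerProductSpace ℂ H₀)
    (W : H₀ ≃ₗᵢ[ℂ] H₀), HasSimpleSpectrum W ∧
    ∃ e : E ≃ₗᵢ[ℂ] PiLp 2 (fun _ : Fin m => H₀),
      ∀ (f : E) (i : Fin m), e (U f) i = W (e f i)

/-- The closed subspace of `L²(μ)` of functions invariant (a.e.) under each of a
given family of measure preserving transformations. -/
noncomputable def aeInvariantSubmodule {α : Type*} [MeasurableSpace α]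
    (μ : Measure α) (S : Set (α → α))
    (hS : ∀ T ∈ S, MeasurePreserving T μ μ) : Submodule ℂ (Lp ℂ 2 μ) where
  carrier := {f | ∀ T ∈ S, (↑↑f ∘ T : α → ℂ) =ᵐ[μ] ↑↑f}
  add_mem' := by
    intro f g hf hg T hT
    have h1 := (hS T hT).quasiMeasurePreserving.ae_eq (Lp.coeFn_add f g)
    filter_upwards [h1, hf T hT, hg T hT, Lp.coeFn_add f g] with x e1 e2 e3 e4
    simp only [Function.comp_apply, Pi.add_apply] at *
    rw [e1, e2, e3, e4]
  zero_mem' := by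
    intro T hT
    have h1 := (hS T hT).quasiMeasurePreserving.ae_eq (Lp.coeFn_zero ℂ 2 μ)
    filter_upwards [h1, Lp.coeFn_zero ℂ 2 μ] with x e1 e2
    simp only [Function.comp_apply, Pi.zero_apply] at *
    rw [e1, e2]
  smul_mem' := by
    intro c f hf T hT
    have h1 := (hS T hT).quasiMeasurePreserving.ae_eq (Lp.coeFn_smul c f)
    filter_upwards [h1, hf T hT, Lp.coeFn_smul c f] with x e1 e2 e3
    simp only [Function.comp_apply, Pi.smul_apply] at *
    rw [e1, e2, e3]

/-- Permuting the coordinates of `𝕋^k` preserves the product measure `σ^k`. -/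
theorem permMeasurePreserving (k : ℕ) (σ : Measure Circle) [IsFiniteMeasure σ]
    (γ : Equiv.Perm (Fin k)) :
    MeasurePreserving (fun x : Fin k → Circle => x ∘ γ)
      (Measure.pi fun _ => σ) (Measure.pi fun _ => σ) := by
  have h := measurePreserving_piCongrLeft (fun _ : Fin k => σ) γ.symm
  convert h using 1
  funext x i
  show x (γ i) = _
  rw [MeasurableEquiv.coe_piCongrLeft]
  have h2 := Equiv.piCongrLeft_apply_apply (fun _ : Fin k => Circle) γ.symm x (γ i)
  simpa using h2.symm

/-- The subspace of `L²(𝕋^k, σ^k)` of functions invariant under a subgroup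
`Γ ≤ S_k` permuting the coordinates: the model for the `Γ`-invariant tensors
in the `k`-th tensor power of `L²(𝕋,σ)`. -/
noncomputable def permInvariantSubspace (k : ℕ) (σ : Measure Circle)
    [IsFiniteMeasure σ] (Γ : Subgroup (Equiv.Perm (Fin k))) :
    Submodule ℂ (Lp ℂ 2 (Measure.pi fun _ : Fin k => σ)) :=
  aeInvariantSubmodule _ {g | ∃ γ ∈ Γ, g = fun x => x ∘ γ}
    (by rintro g ⟨γ, -, rfl⟩; exact permMeasurePreserving k σ γ)

/-- The restriction of a unitary operator to a subspace which it preserves in both directions. -/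
noncomputable def restrictUnitary {L : Type*} [NormedAddCommGroup L] [InnerProductSpace ℂ L]
    (M : L ≃ₗᵢ[ℂ] L) (S : Submodule ℂ L) (h : ∀ x, M x ∈ S ↔ x ∈ S) : S ≃ₗᵢ[ℂ] S :=
  LinearIsometryEquiv.ofSurjective
    { toLinearMap := (M.toLinearEquiv : L →ₗ[ℂ] L).restrict fun x hx => (h x).2 hx
      norm_map' := fun x => M.norm_map x }
    (fun y => ⟨⟨M.symm y, (h _).1 (by simp)⟩, Subtype.ext (M.apply_symm_apply y)⟩)

theorem coe_restrictUnitary {L : Type*} [NormedAddCommGroup L] [InnerProductSpace ℂ L]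
    (M : L ≃ₗᵢ[ℂ] L) (S : Submodule ℂ L) (h : ∀ x, M x ∈ S ↔ x ∈ S) (x : S) :
    (restrictUnitary M S h x : L) = M x := rfl

/-- Simple spectrum passes to factors: if a continuous surjection intertwines `U` and `W`
and `U` has simple spectrum, so has `W`. -/
theorem HasSimpleSpectrum.of_surjective {E F : Type*} [NormedAddCommGroup E]
    [InnerProductSpace ℂ E] [NormedAddCommGroup F] [InnerProductSpace ℂ F]
    {U : E ≃ₗᵢ[ℂ] E} {W : F ≃ₗᵢ[ℂ] F} (hU : HasSimpleSpectrum U) (A : E →ₗ[ℂ] F)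
    (hA : Continuous A) (hsurj : Function.Surjective A) (hUW : ∀ x, A (U x) = W (A x)) :
    HasSimpleSpectrum W := by
  obtain ⟨ξ, hξ⟩ := hU
  have hsymm : ∀ x, A (U⁻¹ x) = W⁻¹ (A x) := by
    intro x
    apply W.injective
    rw [← hUW]
    change A (U (U.symm x)) = W (W.symm (A x))
    simp
  have hpow : ∀ n : ℤ, ∀ x, A ((U ^ n) x) = (W ^ n) (A x) := by
    intro n
    induction n using Int.induction_on with
    | zero => intro x; rfl
    | succ n ih =>
      intro x
      rw [zpow_add_one, zpow_add_one]
      exact (ih (U x)).trans (by rw [hUW]; rfl)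
    | pred n ih =>
      intro x
      rw [zpow_sub_one, zpow_sub_one]
      exact (ih (U⁻¹ x)).trans (by rw [hsymm]; rfl)
  refine ⟨A ξ, ?_⟩
  have h := hsurj.denseRange.dense_image hA hξ
  rw [← Submodule.map_coe, Submodule.map_span, ← Set.range_comp] at h
  simpa [Function.comp_def, hpow] using h

/-- The sum over a finite group of a function of left cosets. -/
theorem sum_quotient_mk {G : Type*} [Group G] [Fintype G] (Γ : Subgroup G) [Fintype (G ⧸ Γ)]
    (F : G ⧸ Γ → ℝ) :
    ∑ g : G, F (QuotientGroup.mk g) = Nat.card Γ * ∑ q, F q := by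
  classical
  have := Fintype.ofFinite Γ
  have hmk : ∀ p : (G ⧸ Γ) × Γ, (QuotientGroup.mk (p.1.out * (p.2 : G)) : G ⧸ Γ) = p.1 := by
    intro p
    rw [QuotientGroup.mk_mul_of_mem _ p.2.2, QuotientGroup.out_eq']
  have hbij : Function.Bijective fun p : (G ⧸ Γ) × Γ => p.1.out * (p.2 : G) := by
    refine ⟨fun p p' h => ?_, fun g => ?_⟩
    · have h1 : p.1 = p'.1 := by rw [← hmk p, ← hmk p']; exact congrArg _ h
      refine Prod.ext h1 (Subtype.ext ?_)
      simpa [h1] using h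
    · obtain ⟨γ, hγ⟩ := QuotientGroup.mk_out_eq_mul Γ g
      exact ⟨(QuotientGroup.mk g, γ⁻¹), by simp [hγ]⟩
  rw [← Fintype.sum_bijective _ hbij (fun p => F p.1) _ fun p => by rw [hmk],
    Fintype.sum_prod_type, Finset.mul_sum]
  simp

section WanderingProjection

variable {G L : Type} [Group G] [Fintype G] [NormedAddCommGroup L] [InnerProductSpace ℂ L]

/-- If the translates of a projection `P` under a finite group action decompose the space, then
the subspace fixed by a subgroup `Γ` is a sum of copies of the range of `P` indexed by `G ⧸ Γ`,
compatibly with every operator commuting with `P` and with the action. -/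
theorem exists_equiv_of_wandering_projection (T : G →* (L →ₗ[ℂ] L)) (P : L →ₗ[ℂ] L)
    (hdisj : ∀ g ≠ 1, ∀ f, P f = f → P (T g f) = 0)
    (hnorm : ∀ f, ‖f‖ ^ 2 = ∑ g, ‖P (T g f)‖ ^ 2)
    (K : Submodule ℂ L) (hK : ∀ f, f ∈ K ↔ P f = f) (hP : ∀ f, P f ∈ K)
    (Γ : Subgroup G) (S : Submodule ℂ L) (hS : ∀ f, f ∈ S ↔ ∀ γ ∈ Γ, T γ f = f)
    {m : ℕ} (ε : G ⧸ Γ ≃ Fin m) :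
    ∃ e : S ≃ₗᵢ[ℂ] PiLp 2 (fun _ : Fin m => K), ∀ f i,
      (e f i : L) = ((√(Nat.card Γ) : ℝ) : ℂ) • P (T (ε.symm i).out f) := by
  classical
  have := Fintype.ofFinite (G ⧸ Γ)
  have hT : ∀ g h f, T g (T h f) = T (g * h) f := fun g h f => by rw [map_mul]; rfl
  have hΓ : (0 : ℝ) < Nat.card Γ := by exact_mod_cast Nat.card_pos
  have hout : ∀ f ∈ S, ∀ g : G, T (QuotientGroup.mk g : G ⧸ Γ).out f = T g f := by
    intro f hf g
    obtain ⟨γ, hγ⟩ := QuotientGroup.mk_out_eq_mul Γ g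
    rw [hγ, ← hT, (hS f).1 hf _ γ.2]
  let A : S →ₗ[ℂ] PiLp 2 (fun _ : Fin m => K) :=
    (WithLp.linearEquiv 2 ℂ (Fin m → K)).symm.toLinearMap ∘ₗ
      LinearMap.pi fun i => ((√(Nat.card Γ) : ℝ) : ℂ) •
        ((P.codRestrict K hP) ∘ₗ (T (ε.symm i).out) ∘ₗ S.subtype)
  have hA : ∀ f i, (A f i : L) = ((√(Nat.card Γ) : ℝ) : ℂ) • P (T (ε.symm i).out f) :=
    fun f i => rfl
  have hnormA : ∀ f, ‖A f‖ = ‖f‖ := by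
    intro f
    rw [← sq_eq_sq₀ (norm_nonneg _) (norm_nonneg _), PiLp.norm_sq_eq_of_L2, Submodule.coe_norm f,
      hnorm]
    calc ∑ i, ‖A f i‖ ^ 2
        = ∑ i, (Nat.card Γ : ℝ) * ‖P (T (ε.symm i).out f)‖ ^ 2 := by
          refine Finset.sum_congr rfl fun i _ => ?_
          rw [Submodule.coe_norm, hA, norm_smul, mul_pow, Complex.norm_real, Real.norm_eq_abs,
            sq_abs, Real.sq_sqrt hΓ.le]
      _ = (Nat.card Γ : ℝ) * ∑ q : G ⧸ Γ, ‖P (T q.out f)‖ ^ 2 := by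
          rw [← Finset.mul_sum, ε.symm.sum_comp fun q => ‖P (T q.out f)‖ ^ 2]
      _ = ∑ g, ‖P (T g f)‖ ^ 2 := by
          rw [← sum_quotient_mk Γ fun q => ‖P (T q.out f)‖ ^ 2]
          exact Finset.sum_congr rfl fun g _ => by rw [hout f f.2]
  have hsurj : Function.Surjective A := by
    intro h
    have hc : ((√(Nat.card Γ) : ℝ) : ℂ) ≠ 0 := by
      exact_mod_cast (Real.sqrt_pos.2 hΓ).ne'
    let f₀ : L := ∑ g, T g⁻¹ (h (ε (QuotientGroup.mk g)) : L)
    have hf₀ : f₀ ∈ S := by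
      refine (hS _).2 fun γ hγ => ?_
      simp only [f₀, map_sum, hT]
      refine Fintype.sum_equiv (Equiv.mulRight γ⁻¹) _ _ fun g => ?_
      simp only [Equiv.coe_mulRight, mul_inv_rev, inv_inv]
      rw [QuotientGroup.mk_mul_of_mem _ (Γ.inv_mem hγ)]
    have hproj : ∀ a : G, P (T a f₀) = h (ε (QuotientGroup.mk a)) := by
      intro a
      simp only [f₀, map_sum, hT]
      rw [Finset.sum_eq_single a]
      · rw [mul_inv_cancel, map_one]
        exact (hK _).1 (h (ε (QuotientGroup.mk a))).2
      · intro b _ hb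
        exact hdisj _ (fun h1 => hb (mul_inv_eq_one.1 h1).symm) _ ((hK _).1 (Subtype.property _))
      · simp
    refine ⟨((√(Nat.card Γ) : ℝ) : ℂ)⁻¹ • ⟨f₀, hf₀⟩, ?_⟩
    ext i
    rw [hA]
    simp only [Submodule.coe_smul, map_smul, hproj, smul_inv_smul₀ hc, QuotientGroup.out_eq',
      Equiv.apply_symm_apply]
  exact ⟨LinearIsometryEquiv.ofSurjective ⟨A, hnormA⟩ hsurj, hA⟩

/-- Simplicity of the spectrum on the fixed space of a finite group `G` acting with a wandering
projection implies homogeneity of the spectrum on the fixed space of every subgroup. -/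
theorem hasHomogeneousSpectrum_of_wandering_projection (T : G →* (L →ₗ[ℂ] L)) (P : L →L[ℂ] L)
    (hidem : ∀ f, P (P f) = P f)
    (hdisj : ∀ g ≠ 1, ∀ f, P f = f → P (T g f) = 0)
    (hnorm : ∀ f, ‖f‖ ^ 2 = ∑ g, ‖P (T g f)‖ ^ 2)
    (M : L ≃ₗᵢ[ℂ] L) (hMP : ∀ f, M (P f) = P (M f)) (hMT : ∀ g f, M (T g f) = T g (M f))
    (R : Submodule ℂ L) (hR : ∀ f, f ∈ R ↔ ∀ g, T g f = f)
    (hsimple : ∀ U : R ≃ₗᵢ[ℂ] R, (∀ f : R, (U f : L) = M f) → HasSimpleSpectrum U)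
    (Γ : Subgroup G) (S : Submodule ℂ L) (hS : ∀ f, f ∈ S ↔ ∀ γ ∈ Γ, T γ f = f)
    (U : S ≃ₗᵢ[ℂ] S) (hU : ∀ f : S, (U f : L) = M f) {m : ℕ} (ε : G ⧸ Γ ≃ Fin m) :
    HasHomogeneousSpectrumOfMultiplicity U m := by
  classical
  let K : Submodule ℂ L := LinearMap.eqLocus (P : L →ₗ[ℂ] L) LinearMap.id
  have hK : ∀ f, f ∈ K ↔ P f = f := fun f => Iff.rfl
  have hPK : ∀ f, P f ∈ K := hidem
  have hMK : ∀ f, M f ∈ K ↔ f ∈ K := fun f => by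
    rw [hK, hK, ← hMP, M.injective.eq_iff]
  have hMR : ∀ f, M f ∈ R ↔ f ∈ R := fun f => by
    simp only [hR, ← hMT, M.injective.eq_iff]
  obtain ⟨e, he⟩ := exists_equiv_of_wandering_projection T P hdisj hnorm K hK hPK Γ S hS ε
  refine ⟨K, inferInstance, inferInstance, restrictUnitary M K hMK, ?_, e, ?_⟩
  · refine (hsimple (restrictUnitary M R hMR) fun f => rfl).of_surjective
      (((P : L →ₗ[ℂ] L).codRestrict K hPK) ∘ₗ R.subtype) ?_ ?_ ?_
    · exact (P.continuous.comp continuous_subtype_val).subtype_mk _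
    · intro h
      have hsum : ∑ g, T g (h : L) ∈ R := by
        refine (hR _).2 fun a => ?_
        rw [map_sum]
        refine Fintype.sum_equiv (Equiv.mulLeft a) _ _ fun g => ?_
        rw [Equiv.coe_mulLeft, map_mul]
        rfl
      refine ⟨⟨_, hsum⟩, Subtype.ext ?_⟩
      change P (∑ g, T g (h : L)) = h
      rw [map_sum, Finset.sum_eq_single 1 (fun g _ hg => hdisj g hg _ h.2) (by simp), map_one]
      exact h.2
    · intro x
      exact Subtype.ext (hMP x).symm
  · intro f i
    apply Subtype.ext
    rw [coe_restrictUnitary, he, he, hU, ← hMT, map_smul]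
    exact congrArg _ (hMP _).symm

end WanderingProjection

section Multiplication

variable {α : Type*} [MeasurableSpace α] {μ : Measure α}

theorem memLp_bounded_mul (φ : α → ℂ) (hφ : Measurable φ) (hb : ∀ x, ‖φ x‖ ≤ 1)
    (f : Lp ℂ 2 μ) : MemLp (fun x => φ x * f x) 2 μ :=
  (Lp.memLp f).of_le (hφ.aestronglyMeasurable.mul (Lp.aestronglyMeasurable f))
    (.of_forall fun x => by
      rw [norm_mul]
      exact mul_le_of_le_one_left (norm_nonneg _) (hb x))

/-- Multiplication by a measurable function bounded by `1`, as an operator on `L²`. -/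
noncomputable def mulLp (φ : α → ℂ) (hφ : Measurable φ) (hb : ∀ x, ‖φ x‖ ≤ 1) :
    Lp ℂ 2 μ →L[ℂ] Lp ℂ 2 μ :=
  LinearMap.mkContinuous
    { toFun := fun f => (memLp_bounded_mul φ hφ hb f).toLp _
      map_add' := fun f g => by
        apply Lp.ext
        grw [Lp.coeFn_add, MemLp.coeFn_toLp, MemLp.coeFn_toLp, MemLp.coeFn_toLp]
        filter_upwards [Lp.coeFn_add f g] with x hx
        rw [hx, Pi.add_apply, Pi.add_apply, mul_add]
      map_smul' := fun c f => by
        apply Lp.ext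
        grw [Lp.coeFn_smul, MemLp.coeFn_toLp, MemLp.coeFn_toLp]
        filter_upwards [Lp.coeFn_smul c f] with x hx
        rw [hx]
        simp [mul_left_comm] } 1
    (fun f => by
      rw [one_mul]
      refine Lp.norm_le_norm_of_ae_le ?_
      filter_upwards [MemLp.coeFn_toLp (memLp_bounded_mul φ hφ hb f)] with x hx
      simp only [LinearMap.coe_mk, AddHom.coe_mk]
      rw [hx, norm_mul]
      exact mul_le_of_le_one_left (norm_nonneg _) (hb x))

theorem coeFn_mulLp (φ : α → ℂ) (hφ : Measurable φ) (hb : ∀ x, ‖φ x‖ ≤ 1) (f : Lp ℂ 2 μ) :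
    ⇑(mulLp φ hφ hb f) =ᵐ[μ] fun x => φ x * f x :=
  MemLp.coeFn_toLp (memLp_bounded_mul φ hφ hb f)

/-- Multiplication by a measurable function of modulus one, as a unitary operator on `L²`. -/
noncomputable def unimodularMulLp (φ : α → ℂ) (hφ : Measurable φ) (h1 : ∀ x, ‖φ x‖ = 1) :
    Lp ℂ 2 μ ≃ₗᵢ[ℂ] Lp ℂ 2 μ :=
  LinearIsometryEquiv.ofSurjective
    { toLinearMap := (mulLp φ hφ fun x => (h1 x).le : Lp ℂ 2 μ →L[ℂ] Lp ℂ 2 μ).toLinearMap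
      norm_map' := fun f => by
        refine le_antisymm (Lp.norm_le_norm_of_ae_le ?_) (Lp.norm_le_norm_of_ae_le ?_) <;>
        · filter_upwards [coeFn_mulLp φ hφ (fun x => (h1 x).le) f] with x hx
          have hn : ‖mulLp φ hφ (fun x => (h1 x).le) f x‖ = ‖f x‖ := by
            rw [hx, norm_mul, h1, one_mul]
          first | exact hn.le | exact hn.ge }
    (fun f => by
      have hb : ∀ x, ‖(φ x)⁻¹‖ ≤ 1 := fun x => by simp [h1]
      refine ⟨mulLp (fun x => (φ x)⁻¹) hφ.inv hb f, Lp.ext ?_⟩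
      refine (coeFn_mulLp φ hφ (fun x => (h1 x).le) _).trans ?_
      filter_upwards [coeFn_mulLp (fun x => (φ x)⁻¹) hφ.inv hb f] with x hx
      have : φ x ≠ 0 := fun h => by simpa [h] using h1 x
      rw [hx, mul_inv_cancel_left₀ this])

theorem coeFn_unimodularMulLp (φ : α → ℂ) (hφ : Measurable φ) (h1 : ∀ x, ‖φ x‖ = 1)
    (f : Lp ℂ 2 μ) : ⇑(unimodularMulLp φ hφ h1 f) =ᵐ[μ] fun x => φ x * f x :=
  coeFn_mulLp φ hφ (fun x => (h1 x).le) f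

theorem norm_sq_eq_integral_norm_sq (f : Lp ℂ 2 μ) : ‖f‖ ^ 2 = ∫ x, ‖f x‖ ^ 2 ∂μ := by
  have h := congrArg Complex.re (L2.inner_def (𝕜 := ℂ) f f)
  rw [inner_self_eq_norm_sq_to_K] at h
  simp only [inner_self_eq_norm_sq_to_K] at h
  norm_cast at h

end Multiplication

theorem measurable_circle_coe : Measurable fun z : Circle => (z : ℂ) :=
  Continuous.measurable (by fun_prop)

section OrderedTuples

/-- The tuples of points of the circle listed in strictly increasing order of argument. -/
def orderedTuples (k : ℕ) : Set (Fin k → Circle) :=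
  {x | StrictMono fun i => Complex.arg (x i)}

theorem measurableSet_orderedTuples (k : ℕ) : MeasurableSet (orderedTuples k) := by
  have h : orderedTuples k = ⋂ i, ⋂ j, ⋂ _ : i < j,
      {x | Complex.arg (x i) < Complex.arg (x j)} := by
    ext x
    simp [orderedTuples, StrictMono]
  have hm : ∀ i : Fin k, Measurable fun x : Fin k → Circle => Complex.arg (x i) := fun i =>
    Complex.measurable_arg.comp (measurable_circle_coe.comp (measurable_pi_apply i))
  rw [h]
  exact .iInter fun i => .iInter fun j => .iInter fun _ => measurableSet_lt (hm i) (hm j)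

theorem orderedTuples_perm_unique {k : ℕ} {x : Fin k → Circle} {g h : Equiv.Perm (Fin k)}
    (hg : x ∘ g ∈ orderedTuples k) (hh : x ∘ h ∈ orderedTuples k) : g = h := by
  have heq := Tuple.unique_monotone (f := fun i => Complex.arg (x i)) (σ := g) (τ := h)
    (StrictMono.monotone hg) (StrictMono.monotone hh)
  have hinj : Function.Injective fun i => Complex.arg (x i) := by
    intro i j hij
    have := StrictMono.injective hg (a₁ := g.symm i) (a₂ := g.symm j) (by simpa using hij)
    simpa using this
  exact Equiv.ext fun i => hinj (congrFun heq i)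

theorem exists_perm_mem_orderedTuples {k : ℕ} {x : Fin k → Circle} (hx : Function.Injective x) :
    ∃ g : Equiv.Perm (Fin k), x ∘ g ∈ orderedTuples k := by
  refine ⟨Tuple.sort fun i => Complex.arg (x i), ?_⟩
  refine (Tuple.monotone_sort fun i => Complex.arg (x i)).strictMono_of_injective ?_
  exact (Circle.injective_arg.comp hx).comp (Equiv.injective _)

theorem ae_injective_pi (k : ℕ) (σ : Measure Circle) [IsFiniteMeasure σ]
    (hσ : ∀ z : Circle, σ {z} = 0) :
    ∀ᵐ x ∂(Measure.pi fun _ : Fin k => σ), Function.Injective x := by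
  have hne : ∀ i j : Fin k, i ≠ j → ∀ᵐ x ∂(Measure.pi fun _ : Fin k => σ), x i ≠ x j := by
    intro i j hij
    obtain _ | n := k
    · exact i.elim0
    obtain ⟨l, rfl⟩ := Fin.exists_succAbove_eq hij.symm
    have hmp := measurePreserving_piFinSuccAbove (fun _ : Fin (n + 1) => σ) i
    have hset : MeasurableSet {p : Circle × (Fin n → Circle) | p.1 = p.2 l} :=
      measurableSet_eq_fun measurable_fst ((measurable_pi_apply l).comp measurable_snd)
    have hnull : (σ.prod (Measure.pi fun _ : Fin n => σ)) {p | p.1 = p.2 l} = 0 := by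
      rw [Measure.prod_apply_symm hset]
      simp [Set.preimage, hσ]
    have h := hmp.measure_preimage hset.nullMeasurableSet
    rw [ae_iff]
    simp only [not_not]
    exact h.trans hnull
  have hall : ∀ᵐ x ∂(Measure.pi fun _ : Fin k => σ), ∀ i j : Fin k, i ≠ j → x i ≠ x j := by
    simp only [ae_all_iff]
    exact hne
  filter_upwards [hall] with x hx i j hij
  by_contra h
  exact hx i j h hij

end OrderedTuples

section PermutationAction

variable (k : ℕ) (σ : Measure Circle)

theorem measurable_indicator_orderedTuples :
    Measurable ((orderedTuples k).indicator fun _ => (1 : ℂ)) :=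
  measurable_const.indicator (measurableSet_orderedTuples k)

/-- Multiplication by the indicator function of the ordered tuples. -/
noncomputable def orderedProjection :
    Lp ℂ 2 (Measure.pi fun _ : Fin k => σ) →L[ℂ] Lp ℂ 2 (Measure.pi fun _ : Fin k => σ) :=
  mulLp _ (measurable_indicator_orderedTuples k) fun x => by
    by_cases h : x ∈ orderedTuples k <;> simp [h]

theorem coeFn_orderedProjection (f : Lp ℂ 2 (Measure.pi fun _ : Fin k => σ)) :
    ⇑(orderedProjection k σ f) =ᵐ[Measure.pi fun _ : Fin k => σ]
      fun x => (orderedTuples k).indicator (fun _ => (1 : ℂ)) x * f x :=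
  coeFn_mulLp _ _ _ f

/-- Multiplication by `z₁⋯z_k`, the model for the tensor power `V^{⊗k}`. -/
noncomputable def coordProdMul :
    Lp ℂ 2 (Measure.pi fun _ : Fin k => σ) ≃ₗᵢ[ℂ] Lp ℂ 2 (Measure.pi fun _ : Fin k => σ) :=
  unimodularMulLp (fun x => ∏ i, (x i : ℂ))
    (Finset.measurable_prod _ fun i _ =>
      measurable_circle_coe.comp (measurable_pi_apply i))
    (fun x => by simp [Circle.norm_coe])

theorem coeFn_coordProdMul (f : Lp ℂ 2 (Measure.pi fun _ : Fin k => σ)) :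
    ⇑(coordProdMul k σ f) =ᵐ[Measure.pi fun _ : Fin k => σ]
      fun x => (∏ i, (x i : ℂ)) * f x :=
  coeFn_unimodularMulLp _ _ _ f

theorem orderedProjection_idem (f : Lp ℂ 2 (Measure.pi fun _ : Fin k => σ)) :
    orderedProjection k σ (orderedProjection k σ f) = orderedProjection k σ f := by
  refine Lp.ext ?_
  filter_upwards [coeFn_orderedProjection k σ (orderedProjection k σ f),
    coeFn_orderedProjection k σ f] with x h1 h2
  rw [h1, h2]
  by_cases h : x ∈ orderedTuples k <;> simp [h]

theorem coordProdMul_orderedProjection (f : Lp ℂ 2 (Measure.pi fun _ : Fin k => σ)) :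
    coordProdMul k σ (orderedProjection k σ f) = orderedProjection k σ (coordProdMul k σ f) := by
  refine Lp.ext ?_
  filter_upwards [coeFn_coordProdMul k σ (orderedProjection k σ f), coeFn_coordProdMul k σ f,
    coeFn_orderedProjection k σ (coordProdMul k σ f),
    coeFn_orderedProjection k σ f] with x h1 h2 h3 h4
  rw [h1, h3, h2, h4, mul_left_comm]

variable [IsFiniteMeasure σ]

/-- The action of the symmetric group on `L²(𝕋^k, σ^k)` by permuting coordinates. -/
noncomputable def permAction : Equiv.Perm (Fin k) →*
    (Lp ℂ 2 (Measure.pi fun _ : Fin k => σ) →ₗ[ℂ] Lp ℂ 2 (Measure.pi fun _ : Fin k => σ)) where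
  toFun g := (Lp.compMeasurePreservingₗᵢ ℂ _ (permMeasurePreserving k σ g)).toLinearMap
  map_one' := by
    refine LinearMap.ext fun f => Lp.ext ?_
    exact Lp.coeFn_compMeasurePreserving f (permMeasurePreserving k σ 1)
  map_mul' g h := by
    refine LinearMap.ext fun f => Lp.ext ?_
    refine (Lp.coeFn_compMeasurePreserving f (permMeasurePreserving k σ (g * h))).trans ?_
    refine .trans ?_ (Lp.coeFn_compMeasurePreserving _ (permMeasurePreserving k σ g)).symm
    exact ((permMeasurePreserving k σ g).quasiMeasurePreserving.ae_eq
      (Lp.coeFn_compMeasurePreserving f (permMeasurePreserving k σ h))).symm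

theorem coeFn_permAction (g : Equiv.Perm (Fin k))
    (f : Lp ℂ 2 (Measure.pi fun _ : Fin k => σ)) :
    ⇑(permAction k σ g f) =ᵐ[Measure.pi fun _ : Fin k => σ] fun x => f (x ∘ g) :=
  Lp.coeFn_compMeasurePreserving f (permMeasurePreserving k σ g)

theorem mem_permInvariantSubspace_iff (Γ : Subgroup (Equiv.Perm (Fin k)))
    (f : Lp ℂ 2 (Measure.pi fun _ : Fin k => σ)) :
    f ∈ permInvariantSubspace k σ Γ ↔ ∀ γ ∈ Γ, permAction k σ γ f = f := by
  constructor
  · intro hf γ hγ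
    exact Lp.ext ((coeFn_permAction k σ γ f).trans (hf _ ⟨γ, hγ, rfl⟩))
  · rintro hf _ ⟨γ, hγ, rfl⟩
    have h := coeFn_permAction k σ γ f
    rw [hf γ hγ] at h
    exact h.symm

theorem orderedProjection_permAction_eq_zero {g : Equiv.Perm (Fin k)} (hg : g ≠ 1)
    {f : Lp ℂ 2 (Measure.pi fun _ : Fin k => σ)} (hf : orderedProjection k σ f = f) :
    orderedProjection k σ (permAction k σ g f) = 0 := by
  refine Lp.ext ?_
  have hf' := coeFn_orderedProjection k σ f
  rw [hf] at hf'
  filter_upwards [coeFn_orderedProjection k σ (permAction k σ g f), coeFn_permAction k σ g f,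
    (permMeasurePreserving k σ g).quasiMeasurePreserving.ae hf',
    Lp.coeFn_zero ℂ 2 (Measure.pi fun _ : Fin k => σ)] with x h1 h2 h3 h4
  rw [h1, h2, h3, h4]
  by_cases h : x ∈ orderedTuples k
  · have h' : x ∘ g ∉ orderedTuples k := fun h' =>
      hg (orderedTuples_perm_unique (h := 1) h' h)
    simp [h']
  · simp [h]

theorem norm_sq_orderedProjection_permAction (g : Equiv.Perm (Fin k))
    (f : Lp ℂ 2 (Measure.pi fun _ : Fin k => σ)) :
    ‖orderedProjection k σ (permAction k σ g f)‖ ^ 2 =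
      ∫ x, (orderedTuples k).indicator (fun _ => (1 : ℝ)) (x ∘ ⇑g⁻¹) * ‖f x‖ ^ 2
        ∂(Measure.pi fun _ : Fin k => σ) := by
  have hmeas : AEStronglyMeasurable (fun x : Fin k → Circle =>
      (orderedTuples k).indicator (fun _ => (1 : ℝ)) (x ∘ ⇑g⁻¹) * ‖f x‖ ^ 2)
      (Measure.pi fun _ : Fin k => σ) := by
    refine AEStronglyMeasurable.mul ?_ ((Lp.aestronglyMeasurable f).norm.pow 2)
    exact ((measurable_const.indicator (measurableSet_orderedTuples k)).comp
      (permMeasurePreserving k σ g⁻¹).measurable).aestronglyMeasurable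
  have hmp := permMeasurePreserving k σ g
  have hcomp : ∀ F : (Fin k → Circle) → ℝ, AEStronglyMeasurable F (Measure.pi fun _ => σ) →
      ∫ x, F x ∂(Measure.pi fun _ => σ) = ∫ x, F (x ∘ g) ∂(Measure.pi fun _ => σ) := by
    intro F hF
    rw [← hmp.map_eq] at hF
    rw [← integral_map hmp.measurable.aemeasurable hF, hmp.map_eq]
  rw [hcomp _ hmeas, norm_sq_eq_integral_norm_sq]
  refine integral_congr_ae ?_
  filter_upwards [coeFn_orderedProjection k σ (permAction k σ g f),
    coeFn_permAction k σ g f] with x h1 h2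
  have hx : (x ∘ g) ∘ ⇑g⁻¹ = x := by
    ext i
    simp
  rw [h1, h2, hx]
  by_cases h : x ∈ orderedTuples k <;> simp [h]

theorem norm_sq_eq_sum_orderedProjection (hσ : ∀ z : Circle, σ {z} = 0)
    (f : Lp ℂ 2 (Measure.pi fun _ : Fin k => σ)) :
    ‖f‖ ^ 2 = ∑ g, ‖orderedProjection k σ (permAction k σ g f)‖ ^ 2 := by
  simp only [norm_sq_orderedProjection_permAction]
  have hint : Integrable (fun x => ‖f x‖ ^ 2) (Measure.pi fun _ : Fin k => σ) :=
    (Lp.memLp f).integrable_norm_pow two_ne_zero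
  rw [← integral_finsetSum, norm_sq_eq_integral_norm_sq]
  · refine integral_congr_ae ?_
    filter_upwards [ae_injective_pi k σ hσ] with x hx
    obtain ⟨g, hg⟩ := exists_perm_mem_orderedTuples hx
    rw [Finset.sum_eq_single g⁻¹]
    · simp [hg]
    · intro b _ hb
      have : x ∘ ⇑b⁻¹ ∉ orderedTuples k := fun h =>
        hb (by rw [← orderedTuples_perm_unique h hg, inv_inv])
      rw [Set.indicator_of_notMem this, zero_mul]
    · simp
  · intro g _
    refine hint.mono' ?_ (.of_forall fun x => ?_)
    · exact AEStronglyMeasurable.mul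
        ((measurable_const.indicator (measurableSet_orderedTuples k)).comp
          (permMeasurePreserving k σ g⁻¹).measurable).aestronglyMeasurable
        hint.aestronglyMeasurable
    · rw [norm_mul, norm_pow, norm_norm]
      refine mul_le_of_le_one_left (by positivity) ?_
      exact (norm_indicator_le_norm_self _ _).trans (by simp)

theorem coordProdMul_permAction (g : Equiv.Perm (Fin k))
    (f : Lp ℂ 2 (Measure.pi fun _ : Fin k => σ)) :
    coordProdMul k σ (permAction k σ g f) = permAction k σ g (coordProdMul k σ f) := by
  refine Lp.ext ?_
  filter_upwards [coeFn_coordProdMul k σ (permAction k σ g f),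
    (permMeasurePreserving k σ g).quasiMeasurePreserving.ae (coeFn_coordProdMul k σ f),
    coeFn_permAction k σ g (coordProdMul k σ f), coeFn_permAction k σ g f] with x h1 h2 h3 h4
  rw [h1, h3, h2, h4]
  congr 1
  exact (Equiv.prod_comp g fun i => (x i : ℂ)).symm

end PermutationAction

/-- Lemma 1.1.  Let `V` be a unitary operator with simple continuous
spectrum (modelled as multiplication by `z` on `L²(𝕋,σ)` for a continuous measure `σ`)
such that the symmetric power `V^{⊙k}` (the restriction of `V^{⊗k}`, i.e. multiplication
by `z₁⋯z_k` on `L²(𝕋^k,σ^k)`, to the subspace of symmetric functions) has simple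
spectrum.  Then for every subgroup `Γ ≤ S_k`, the restriction `V^{⊗k}_Γ` of `V^{⊗k}`
to the subspace of `Γ`-invariant tensors has homogeneous spectrum of multiplicity
`k!/#Γ`. -/
theorem symmetric_power_restriction_homogeneous_spectrum
    (k : ℕ) (hk : 0 < k) (σ : Measure Circle) [IsFiniteMeasure σ]
    (hσ : ∀ z : Circle, σ {z} = 0)
    (Γ : Subgroup (Equiv.Perm (Fin k)))
    (hsimple : ∀ Usym : ↥(permInvariantSubspace k σ ⊤) ≃ₗᵢ[ℂ]
        ↥(permInvariantSubspace k σ ⊤),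
      (∀ f : ↥(permInvariantSubspace k σ ⊤),
        lpFun (Usym f : Lp ℂ 2 (Measure.pi fun _ : Fin k => σ))
          =ᵐ[Measure.pi fun _ : Fin k => σ]
          fun x => (∏ i, (x i : ℂ)) *
            lpFun (f : Lp ℂ 2 (Measure.pi fun _ : Fin k => σ)) x) →
      HasSimpleSpectrum Usym) :
    ∀ UΓ : ↥(permInvariantSubspace k σ Γ) ≃ₗᵢ[ℂ] ↥(permInvariantSubspace k σ Γ),
      (∀ f : ↥(permInvariantSubspace k σ Γ),
        lpFun (UΓ f : Lp ℂ 2 (Measure.pi fun _ : Fin k => σ))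
          =ᵐ[Measure.pi fun _ : Fin k => σ]
          fun x => (∏ i, (x i : ℂ)) *
            lpFun (f : Lp ℂ 2 (Measure.pi fun _ : Fin k => σ)) x) →
      HasHomogeneousSpectrumOfMultiplicity UΓ (Nat.factorial k / Nat.card Γ) := by
  intro UΓ hUΓ
  have hcard : Nat.card (Equiv.Perm (Fin k) ⧸ Γ) = k.factorial / Nat.card Γ := by
    have h := Subgroup.card_eq_card_quotient_mul_card_subgroup Γ
    rw [Nat.card_perm, Nat.card_fin] at h
    rw [h, Nat.mul_div_cancel _ Nat.card_pos]
  refine hasHomogeneousSpectrum_of_wandering_projection (permAction k σ) (orderedProjection k σ)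
    (orderedProjection_idem k σ)
    (fun g hg f hf => orderedProjection_permAction_eq_zero k σ hg hf)
    (norm_sq_eq_sum_orderedProjection k σ hσ) (coordProdMul k σ)
    (coordProdMul_orderedProjection k σ) (coordProdMul_permAction k σ)
    (permInvariantSubspace k σ ⊤)
    (fun f => by simp [mem_permInvariantSubspace_iff])
    (fun U hU => hsimple U fun f => ?_) Γ (permInvariantSubspace k σ Γ)
    (mem_permInvariantSubspace_iff k σ Γ) UΓ
    (fun f => Lp.ext ((hUΓ f).trans (coeFn_coordProdMul k σ f).symm))
    (Finite.equivFinOfCardEq hcard)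
  rw [hU]
  exact coeFn_coordProdMul k σ f
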